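/- Let F ⊆ (Fin m → ℕ) be hereditary and an M♮-convex set, let X be a finite set of contracts with a map col : X → Fin m, and let w : X → ℝ be injective with w(x) > 0 for all x. Then for every Y ⊆ X there is a unique subset Y' ⊆ Y such that Y' is feasible and w(Y') ≥ w(Y'') for every feasible Y'' ⊆ Y. (Hence the colleges' choice function Ch_C(Y) = argmax_{Y'⊆Y} f(ν(Y')) + w(Y') is well defined.) -/

import Mathlib

/-- The `i`-th standard unit vector in `ℕ^m`. -/
def chi {m : ℕ} (i : Fin m) : Fin m → ℕ := fun j => if j = i then 1 else 0

/-- A family `F ⊆ ℕ^m` is hereditary if it contains `0` and is downward closed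
with respect to the componentwise order. -/
def Hereditary {m : ℕ} (F : Set (Fin m → ℕ)) : Prop :=
  (0 : Fin m → ℕ) ∈ F ∧ ∀ ν ∈ F, ∀ ν' : Fin m → ℕ, ν' ≤ ν → ν' ∈ F

/-- `F ⊆ ℕ^m` is an M♮-convex set: for all `ν, ν' ∈ F` and every index `i` with
`ν i > ν' i`, either (`ν − χᵢ ∈ F` and `ν' + χᵢ ∈ F`) or there exists `j` with
`ν j < ν' j` such that `ν − χᵢ + χⱼ ∈ F` and `ν' + χᵢ − χⱼ ∈ F`. -/
def MNatConvex {m : ℕ} (F : Set (Fin m → ℕ)) : Prop :=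
  ∀ ν ∈ F, ∀ ν' ∈ F, ∀ i : Fin m, ν' i < ν i →
    ((ν - chi i ∈ F ∧ ν' + chi i ∈ F) ∨
      ∃ j : Fin m, ν j < ν' j ∧ ν - chi i + chi j ∈ F ∧ ν' + chi i - chi j ∈ F)

/-- The vector of numbers of contracts in `Y` assigned to each college. -/
def nu {ι : Type*} [DecidableEq ι] {m : ℕ} (col : ι → Fin m) (Y : Finset ι) :
    Fin m → ℕ := fun i => (Y.filter (fun x => col x = i)).card

theorem nu_insert {ι : Type*} [DecidableEq ι] {m : ℕ} (col : ι → Fin m) {x : ι} {B : Finset ι}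
    (hx : x ∉ B) : nu col (insert x B) = nu col B + chi (col x) := by
  funext i
  simp only [nu, chi, Pi.add_apply, Finset.filter_insert]
  by_cases h : col x = i
  · simp [h, hx]
  · simp [h, Ne.symm h]

theorem nu_erase_add {ι : Type*} [DecidableEq ι] {m : ℕ} (col : ι → Fin m) {y : ι} {B : Finset ι}
    (hy : y ∈ B) : nu col (B.erase y) + chi (col y) = nu col B := by
  rw [← nu_insert col (Finset.notMem_erase y B), Finset.insert_erase hy]

/-- Let `B` have at least as many elements of colour `j` as `A`. If `B` has strictly more, or if
some element of `A \ B` has colour `j`, then some element of `B \ A` has colour `j`. -/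
theorem exists_mem_sdiff_of_nu_le {ι : Type*} [DecidableEq ι] {m : ℕ}
    (col : ι → Fin m) {A B : Finset ι} {j : Fin m} (hle : nu col A j ≤ nu col B j)
    (hne : nu col A j < nu col B j ∨ ∃ x ∈ A \ B, col x = j) :
    ∃ y ∈ B \ A, col y = j := by
  by_contra! h
  have hsub : B.filter (fun y => col y = j) ⊆ A.filter (fun y => col y = j) := by
    intro y hy
    have := h y
    grind
  have heq := Finset.eq_of_subset_of_card_le hsub hle
  rcases hne with hlt | ⟨x, hx, hxj⟩
  · exact absurd (Finset.card_le_card hsub) (not_le.mpr hlt)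
  · have : x ∈ B.filter (fun y => col y = j) := by
      rw [heq]
      grind
    grind

/-- The exchange property of feasible sets of contracts over an M♮-convex family. -/
theorem MNatConvex.exchange {m : ℕ} {F : Set (Fin m → ℕ)} (hM : MNatConvex F) {ι : Type*}
    [DecidableEq ι] (col : ι → Fin m) {A B : Finset ι} (hA : nu col A ∈ F) (hB : nu col B ∈ F)
    {x : ι} (hx : x ∈ A \ B) :
    nu col (insert x B) ∈ F ∨ ∃ y ∈ B \ A, nu col (insert x (B.erase y)) ∈ F := by
  have hxB : x ∉ B := (Finset.mem_sdiff.mp hx).2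
  have hswap : ∀ y ∈ B, nu col (insert x (B.erase y)) = nu col B + chi (col x) - chi (col y) := by
    intro y hy
    rw [nu_insert col (fun h => hxB (Finset.mem_of_mem_erase h)), ← nu_erase_add col hy,
      add_right_comm, add_tsub_cancel_right]
  rcases lt_or_ge (nu col B (col x)) (nu col A (col x)) with hlt | hge
  · rcases hM _ hA _ hB _ hlt with ⟨-, h⟩ | ⟨j, hj, -, h⟩
    · exact Or.inl (by rwa [nu_insert col hxB])
    · obtain ⟨y, hy, rfl⟩ := exists_mem_sdiff_of_nu_le col hj.le (Or.inl hj)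
      exact Or.inr ⟨y, hy, by rwa [hswap y (Finset.mem_sdiff.mp hy).1]⟩
  · obtain ⟨y, hy, hyx⟩ :=
      exists_mem_sdiff_of_nu_le col hge (Or.inr ⟨x, hx, rfl⟩)
    refine Or.inr ⟨y, hy, ?_⟩
    rwa [hswap y (Finset.mem_sdiff.mp hy).1, hyx, add_tsub_cancel_right]

/-- If the heaviest element in which two feasible sets differ lies in `A`, then `B` is not of
maximum weight. -/
theorem MNatConvex.exists_sum_lt {m : ℕ} {F : Set (Fin m → ℕ)} (hM : MNatConvex F) {ι : Type*}
    [DecidableEq ι] (col : ι → Fin m) {w : ι → ℝ} (hwpos : ∀ x, 0 < w x) {A B Y : Finset ι}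
    (hAY : A ⊆ Y) (hBY : B ⊆ Y) (hA : nu col A ∈ F) (hB : nu col B ∈ F)
    {x : ι} (hx : x ∈ A \ B) (hmax : ∀ y ∈ B \ A, w y < w x) :
    ∃ C ⊆ Y, nu col C ∈ F ∧ ∑ z ∈ B, w z < ∑ z ∈ C, w z := by
  obtain ⟨hxA, hxB⟩ := Finset.mem_sdiff.mp hx
  rcases hM.exchange col hA hB hx with h | ⟨y, hy, h⟩
  · refine ⟨_, Finset.insert_subset (hAY hxA) hBY, h, ?_⟩
    rw [Finset.sum_insert hxB]
    linarith [hwpos x]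
  · refine ⟨_, Finset.insert_subset (hAY hxA) ((Finset.erase_subset _ _).trans hBY), h, ?_⟩
    rw [Finset.sum_insert (fun h => hxB (Finset.mem_of_mem_erase h)),
      ← Finset.add_sum_erase B w (Finset.mem_sdiff.mp hy).1]
    linarith [hmax y hy]

/-- If `F` is a hereditary M♮-convex set and `w` is injective and positive,
then for every `Y ⊆ X` there is a unique maximum-weight feasible subset of `Y`;
hence the colleges' choice function `Ch_C` is well defined. -/
theorem unique_max_weight_feasible_subset {m : ℕ} (F : Set (Fin m → ℕ)) (hF : Hereditary F)
    (hM : MNatConvex F) {ι : Type*} [Fintype ι] [DecidableEq ι] (col : ι → Fin m)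
    (w : ι → ℝ) (hwinj : Function.Injective w) (hwpos : ∀ x : ι, 0 < w x) :
    ∀ Y : Finset ι, ∃! Y' : Finset ι,
      Y' ⊆ Y ∧ nu col Y' ∈ F ∧
        ∀ Y'' ⊆ Y, nu col Y'' ∈ F → ∑ x ∈ Y'', w x ≤ ∑ x ∈ Y', w x := by
  intro Y
  classical
  have hempty : nu col ∅ ∈ F := by
    have : nu col ∅ = 0 := by
      funext i
      simp [nu]
    exact this ▸ hF.1
  obtain ⟨A, hA, hAmax⟩ := Finset.exists_max_image (Y.powerset.filter (fun Z => nu col Z ∈ F))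
    (fun Z => ∑ x ∈ Z, w x)
    ⟨∅, Finset.mem_filter.mpr ⟨Finset.empty_mem_powerset Y, hempty⟩⟩
  simp only [Finset.mem_filter, Finset.mem_powerset] at hA hAmax
  refine ⟨A, ⟨hA.1, hA.2, fun Z hZ hZF => hAmax Z ⟨hZ, hZF⟩⟩, ?_⟩
  rintro B ⟨hBY, hBF, hBmax⟩
  by_contra hne
  obtain ⟨x, hx, hxmax⟩ := Finset.exists_max_image (symmDiff A B) w
    (Finset.nonempty_iff_ne_empty.mpr fun h => hne (symmDiff_eq_bot.mp h).symm)
  have hlt : ∀ y ∈ symmDiff A B, y ≠ x → w y < w x := fun y hy hyx =>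
    lt_of_le_of_ne (hxmax y hy) (hwinj.ne hyx)
  rcases Finset.mem_symmDiff.mp hx with hxA | hxB
  · obtain ⟨C, hCY, hCF, hC⟩ := hM.exists_sum_lt col hwpos hA.1 hBY hA.2 hBF
      (Finset.mem_sdiff.mpr hxA) (fun y hy => hlt y (by grind [Finset.mem_symmDiff]) (by grind))
    exact absurd (hBmax C hCY hCF) (not_le.mpr hC)
  · obtain ⟨C, hCY, hCF, hC⟩ := hM.exists_sum_lt col hwpos hBY hA.1 hBF hA.2
      (Finset.mem_sdiff.mpr hxB) (fun y hy => hlt y (by grind [Finset.mem_symmDiff]) (by grind))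
    exact absurd (hAmax C ⟨hCY, hCF⟩) (not_le.mpr hC)
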